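/- arXiv:1412.8670 — 2 statements merged into one kernel-verified Lean document; each statement's English description precedes it below -/
import Mathlib

section
/- Any admissible rate pair (R1,R2) for the zero-error binary adder channel with R1 = 1 satisfies R2 ≤ 0.4794. -/
/-- `C1, C2 ⊆ {0,1}^n` form a zero-error codebook pair: the sum map is injective on `C1 × C2`. -/
def ZeroErrorPair {n : ℕ} (C1 C2 : Finset (Fin n → Fin 2)) : Prop :=
  Set.InjOn
    (fun p : (Fin n → Fin 2) × (Fin n → Fin 2) => fun i : Fin n => (p.1 i : ℕ) + (p.2 i : ℕ))
    (↑(C1 ×ˢ C2))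

/-- `(R1, R2)` is admissible for the zero-error binary adder channel. -/
def Admissible (R1 R2 : ℝ) : Prop :=
  0 ≤ R1 ∧ 0 ≤ R2 ∧
    ∀ ε : ℝ, 0 < ε → ∀ N : ℕ, ∃ n : ℕ, N ≤ n ∧
      ∃ C1 C2 : Finset (Fin n → Fin 2), ZeroErrorPair C1 C2 ∧
        (2 : ℝ) ^ ((n : ℝ) * (R1 - ε)) ≤ C1.card ∧
        (2 : ℝ) ^ ((n : ℝ) * (R2 - ε)) ≤ C2.card

open Finset

noncomputable def GG (z : ℝ) : ℝ := ((1+z)*Real.log (1+z) + (1-z)*Real.log (1-z))/2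

lemma GG_neg (z : ℝ) : GG (-z) = GG z := by
  unfold GG
  have : 1 - -z = 1 + z := by ring
  rw [this, ← sub_eq_add_neg]; ring

lemma log_series (z : ℝ) (h0 : 0 < z) (h1 : z < 1) :
    2*z + 2*z^3/3 + 2*z^5/5 ≤ Real.log (1+z) - Real.log (1-z) := by
  have h := Real.hasSum_log_sub_log_of_abs_lt_one (x := z) (by rw [abs_lt]; constructor <;> linarith)
  have h2 := sum_le_hasSum (Finset.range 3) (fun i _ => by positivity) h
  simp [Finset.sum_range_succ] at h2
  norm_num at h2
  linarith

lemma GG_lower_pos (z : ℝ) (h0 : 0 ≤ z) (h1 : z ≤ 1) :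
    z^2/2 + z^4/12 + z^6/30 ≤ GG z := by
  have hm : MonotoneOn (fun z : ℝ => GG z - (z^2/2 + z^4/12 + z^6/30)) (Set.Icc 0 1) := by
    apply monotoneOn_of_deriv_nonneg (convex_Icc 0 1)
    · apply Continuous.continuousOn
      unfold GG
      have c1 : Continuous fun z : ℝ => (1+z)*Real.log (1+z) :=
        Real.continuous_mul_log.comp (by fun_prop : Continuous fun z : ℝ => 1+z)
      have c2 : Continuous fun z : ℝ => (1-z)*Real.log (1-z) :=
        Real.continuous_mul_log.comp (by fun_prop : Continuous fun z : ℝ => 1-z)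
      fun_prop
    · intro z hz
      rw [interior_Icc] at hz
      obtain ⟨hz0, hz1⟩ := hz
      apply DifferentiableAt.differentiableWithinAt
      unfold GG
      have : 1 + z ≠ 0 := by linarith
      have : 1 - z ≠ 0 := by linarith
      fun_prop (disch := assumption)
    · intro z hz
      rw [interior_Icc] at hz
      obtain ⟨hz0, hz1⟩ := hz
      have e1 : 1 + z ≠ 0 := by linarith
      have e2 : 1 - z ≠ 0 := by linarith
      have d1 : HasDerivAt (fun z : ℝ => 1 + z) 1 z := by
        simpa using (hasDerivAt_id z).const_add 1
      have d2 : HasDerivAt (fun z : ℝ => 1 - z) (-1) z := by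
        simpa using (hasDerivAt_id z).const_sub 1
      have d3 := d1.mul (d1.log e1)
      have d4 := d2.mul (d2.log e2)
      have d5 := ((d3.add d4).div_const 2).sub
        ((((hasDerivAt_pow 2 z).div_const 2).add ((hasDerivAt_pow 4 z).div_const 12)).add
          ((hasDerivAt_pow 6 z).div_const 30))
      have d6 : deriv (fun z : ℝ => GG z - (z^2/2 + z^4/12 + z^6/30)) z = _ := d5.deriv
      rw [d6]
      have := log_series z hz0 hz1
      field_simp
      norm_num
      nlinarith
  have := hm (Set.left_mem_Icc.2 zero_le_one) (⟨h0, h1⟩ : z ∈ Set.Icc (0:ℝ) 1) h0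
  simp [GG] at this
  unfold GG
  linarith

lemma GG_lower (z : ℝ) (h0 : -1 ≤ z) (h1 : z ≤ 1) :
    z^2/2 + z^4/12 + z^6/30 ≤ GG z := by
  rcases le_total 0 z with h | h
  · exact GG_lower_pos z h h1
  · have := GG_lower_pos (-z) (by linarith) (by linarith)
    rw [GG_neg] at this
    have e : (-z)^2/2 + (-z)^4/12 + (-z)^6/30 = z^2/2 + z^4/12 + z^6/30 := by ring
    linarith

lemma GG_nonneg (z : ℝ) (h0 : -1 ≤ z) (h1 : z ≤ 1) : 0 ≤ GG z :=
  le_trans (by positivity) (GG_lower z h0 h1)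

lemma GG_l0 (z : ℝ) (h0 : -1 ≤ z) (h1 : z ≤ 1) : z^2/2 ≤ GG z := by
  have := GG_lower z h0 h1
  have : 0 ≤ z^4/12 + z^6/30 := by positivity
  linarith

lemma GG_l1 (z : ℝ) (h0 : -1 ≤ z) (h1 : z ≤ 1) : -0.008 + 0.5493*z^2 ≤ GG z := by
  have := GG_lower z h0 h1
  have hZ : 0 ≤ z^2 := by positivity
  nlinarith [sq_nonneg (z^2 - 0.25), mul_nonneg hZ (sq_nonneg (z^2 - 0.25))]

lemma GG_l2 (z : ℝ) (h0 : -1 ≤ z) (h1 : z ≤ 1) : -0.08 + 0.6866*z^2 ≤ GG z := by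
  have := GG_lower z h0 h1
  have hZ : 0 ≤ z^2 := by positivity
  nlinarith [sq_nonneg (z^2 - 0.74), mul_nonneg hZ (sq_nonneg (z^2 - 0.74))]

/-- polynomial inequality, `0 ≤ x, y ≤ 1` -/
lemma poly0 (x y : ℝ) (hx : 0 ≤ x) (hx1 : x ≤ 1) (hy : 0 ≤ y) (hy1 : y ≤ 0.35) :
    0 ≤ (-0.329475*(x*y) + 0.89*x^2/2)*(1+x*y) + 0.075*(0.5*(x+y)^2) := by
  have h3 : 0 ≤ x*y*(x - 0.28*y)^2 := by positivity
  have key : 0 ≤ (0.445 + 0.0375 - 0.329475*y^2+0.445*0.56*y^2)*x^2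
      + (-0.329475+0.075-0.445*0.0784*y^2)*y*x + 0.0375*y^2 := by
    have : 0 ≤ y^2 := by positivity
    have : y^2 ≤ 0.1225 := by nlinarith
    nlinarith [sq_nonneg (x - 0.27*y)]
  nlinarith

lemma quad_nonneg (a b c x : ℝ) (ha : 0 < a) (h : b^2 ≤ 4*a*c) : 0 ≤ a*x^2+b*x+c := by
  have h1 : 0 ≤ 4*a*(a*x^2+b*x+c) := by nlinarith [sq_nonneg (2*a*x+b)]
  by_contra hn
  push Not at hn
  nlinarith

lemma poly1 (x y : ℝ) (hx : 0 ≤ x) (hy : 0.35 ≤ y) (hy1 : y ≤ 0.65) :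
    0 ≤ (-0.329475*(x*y) + 0.89*x^2/2)*(1+x*y) + 0.075*(-0.008*(1+x*y)^2 + 0.5493*(x+y)^2) := by
  have hy0 : 0 ≤ y := by linarith
  have h3 : 0 ≤ x*y*(x - 0.28*y)^2 := by positivity
  have hY0 : 0.1225 ≤ y^2 := by nlinarith
  have hY1 : y^2 ≤ 0.4225 := by nlinarith
  have key := quad_nonneg (0.445 - 0.329475*y^2 + 0.075*(-0.008*y^2+0.5493)+0.445*0.56*y^2)
    ((-0.329475+0.15*(-0.008)+0.15*0.5493-0.445*0.0784*y^2)*y) (0.075*(-0.008+0.5493*y^2)) x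
    (by nlinarith) (by
      rw [mul_pow]
      generalize y^2 = Y at *
      have : 0 ≤ (Y-0.1225)*(0.4225-Y) := mul_nonneg (by linarith) (by linarith)
      nlinarith [mul_nonneg this (by linarith : (0:ℝ) ≤ Y)])
  nlinarith

lemma poly2 (x y : ℝ) (hx : 0 ≤ x) (hy : 0.65 ≤ y) (hy1 : y ≤ 1) :
    0 ≤ (-0.329475*(x*y) + 0.89*x^2/2)*(1+x*y) + 0.075*(-0.08*(1+x*y)^2 + 0.6866*(x+y)^2) := by
  have hy0 : 0 ≤ y := by linarith
  have h3 : 0 ≤ x*y*(x - 0.31*y)^2 := by positivity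
  have hY0 : 0.4225 ≤ y^2 := by nlinarith
  have hY1 : y^2 ≤ 1 := by nlinarith
  have key := quad_nonneg (0.445 - 0.329475*y^2 + 0.075*(-0.08*y^2+0.6866)+0.445*0.62*y^2)
    ((-0.329475+0.15*(-0.08)+0.15*0.6866-0.445*0.0961*y^2)*y) (0.075*(-0.08+0.6866*y^2)) x
    (by nlinarith) (by
      rw [mul_pow]
      generalize y^2 = Y at *
      have : 0 ≤ (Y-0.4225)*(1-Y) := mul_nonneg (by linarith) (by linarith)
      nlinarith [mul_nonneg this (by linarith : (0:ℝ) ≤ Y)])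
  nlinarith

lemma z_range (x y : ℝ) (hx : -1 ≤ x) (hx1 : x ≤ 1) (hy : -1 ≤ y) (hy1 : y ≤ 1) :
    -1 ≤ (x+y)/(1+x*y) ∧ (x+y)/(1+x*y) ≤ 1 := by
  have h0 : 0 ≤ 1 + x*y := by nlinarith
  constructor
  · rcases h0.eq_or_lt with h | h
    · rw [← h]; simp
    · rw [le_div_iff₀ h]; nlinarith
  · apply div_le_one_of_le₀ _ h0
    nlinarith

lemma letter_pos (x y : ℝ) (hx : 0 ≤ x) (hx1 : x ≤ 1) (hy : 0 ≤ y) (hy1 : y ≤ 1) :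
    0.329475*(x*y) ≤ 0.89*GG x + 0.075*(1+x*y)*GG ((x+y)/(1+x*y)) := by
  have hz := z_range x y (by linarith) hx1 (by linarith) hy1
  have ht : 0 < 1 + x*y := by positivity
  have hgx := GG_l0 x (by linarith) hx1
  have red : ∀ g c : ℝ, g + c*((x+y)/(1+x*y))^2 ≤ GG ((x+y)/(1+x*y)) →
      0 ≤ (-0.329475*(x*y) + 0.89*x^2/2)*(1+x*y) + 0.075*(g*(1+x*y)^2 + c*(x+y)^2) →
      0.329475*(x*y) ≤ 0.89*GG x + 0.075*(1+x*y)*GG ((x+y)/(1+x*y)) := by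
    intro g c h1 h2
    have h3 : 0.075*(1+x*y)*(g + c*((x+y)/(1+x*y))^2) ≤ 0.075*(1+x*y)*GG ((x+y)/(1+x*y)) :=
      mul_le_mul_of_nonneg_left h1 (by positivity)
    have h4 : 0 ≤ (-0.329475*(x*y) + 0.89*x^2/2) + 0.075*(1+x*y)*(g + c*((x+y)/(1+x*y))^2) := by
      have : (-0.329475*(x*y) + 0.89*x^2/2) + 0.075*(1+x*y)*(g + c*((x+y)/(1+x*y))^2)
        = ((-0.329475*(x*y) + 0.89*x^2/2)*(1+x*y) + 0.075*(g*(1+x*y)^2 + c*(x+y)^2))/(1+x*y) := by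
        field_simp
      rw [this]; positivity
    linarith
  rcases le_total y 0.35 with h | h
  · refine red 0 0.5 ?_ ?_
    · have := GG_l0 _ hz.1 hz.2
      linarith
    · have := poly0 x y hx hx1 hy h
      linarith
  rcases le_total y 0.65 with h' | h'
  · exact red (-0.008) 0.5493 (GG_l1 _ hz.1 hz.2) (poly1 x y hx h h')
  · exact red (-0.08) 0.6866 (GG_l2 _ hz.1 hz.2) (poly2 x y hx h' hy1)

lemma letter_ineq (x y : ℝ) (hx : -1 ≤ x) (hx1 : x ≤ 1) (hy : -1 ≤ y) (hy1 : y ≤ 1) :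
    0.329475*(x*y) ≤ 0.89*GG x + 0.075*(1+x*y)*GG ((x+y)/(1+x*y)) := by
  have triv : x*y ≤ 0 → 0.329475*(x*y) ≤ 0.89*GG x + 0.075*(1+x*y)*GG ((x+y)/(1+x*y)) := by
    intro h
    have hz := z_range x y hx hx1 hy hy1
    have := GG_nonneg x hx hx1
    have := GG_nonneg _ hz.1 hz.2
    have h0 : 0 ≤ 1 + x*y := by nlinarith
    have : 0 ≤ 0.89*GG x + 0.075*(1+x*y)*GG ((x+y)/(1+x*y)) := by positivity
    linarith
  rcases le_total 0 x with h | h <;> rcases le_total 0 y with h' | h'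
  · exact letter_pos x y h hx1 h' hy1
  · exact triv (by nlinarith)
  · exact triv (by nlinarith)
  · have := letter_pos (-x) (-y) (by linarith) (by linarith) (by linarith) (by linarith)
    rw [GG_neg, neg_mul_neg, show -x + -y = -(x+y) by ring, neg_div, GG_neg] at this
    exact this


def agr {n : ℕ} (C : Finset (Fin n → Fin 2)) (S : Fin n → Bool) (u : Fin n → Fin 2) :
    Finset (Fin n → Fin 2) := C.filter (fun a => ∀ i, S i = true → a i = u i)

def hslice {n : ℕ} (C : Finset (Fin (n+1) → Fin 2)) (j : Fin 2) : Finset (Fin n → Fin 2) :=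
  Finset.univ.filter (fun b => (Fin.cons j b : Fin (n+1) → Fin 2) ∈ C)

lemma card_hslice {n : ℕ} (C : Finset (Fin (n+1) → Fin 2)) :
    C.card = (hslice C 0).card + (hslice C 1).card := by
  have h : C.card = ∑ a : Fin (n+1) → Fin 2, if a ∈ C then 1 else 0 := by simp
  rw [h, ← (Fin.consEquiv (fun _ : Fin (n+1) => Fin 2)).sum_comp, Fintype.sum_prod_type,
    Fin.sum_univ_two]
  simp only [hslice, Finset.card_filter]
  rfl

lemma agr_hslice {n : ℕ} (C : Finset (Fin (n+1) → Fin 2)) (s : Bool) (S : Fin n → Bool)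
    (u : Fin (n+1) → Fin 2) (j : Fin 2) (hj : s = true → j = u 0) :
    hslice (agr C (Fin.cons s S : Fin (n+1) → Bool) u) j = agr (hslice C j) S (Fin.tail u) := by
  ext b
  rw [hslice, mem_filter, agr, mem_filter, agr, mem_filter, hslice, mem_filter]
  simp only [mem_univ, true_and, Fin.forall_fin_succ, Fin.cons_zero, Fin.cons_succ, Fin.tail]
  tauto

lemma agr_mono {n : ℕ} {C C' : Finset (Fin n → Fin 2)} (h : C ⊆ C') (S u) :
    agr C S u ⊆ agr C' S u := filter_subset_filter _ h

lemma soft (k : ℕ) (κ τ : ℝ) (hk0 : k ≠ 0) (hκ : 0 ≤ κ) (hτ : 0 ≤ τ)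
    (hk : ∀ X Y : ℝ, 0 ≤ Y → Y ≤ X → κ*(X+Y)^k ≤ X^k + (1+τ)*Y^k) (n : ℕ) :
    ∀ C : Finset (Fin n → Fin 2), ∃ m : (Fin n → Bool) → ℕ,
      (∀ S u, m S ≤ (agr C S u).card) ∧
      κ^n * (C.card:ℝ)^k ≤ ∑ S, (∏ i, if S i = true then τ else 1) * (m S : ℝ) := by
  induction n with
  | zero =>
    intro C
    refine ⟨fun _ => C.card, ?_, ?_⟩
    · intro S u
      apply card_le_card
      intro a ha
      simp [agr, ha]
    · have : C.card ≤ 1 := by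
        apply card_le_one.2
        intro a _ b _
        exact Subsingleton.elim a b
      interval_cases h : C.card <;> simp [hk0]
  | succ n ih =>
    intro C
    obtain ⟨mu, hu, hu'⟩ := ih (hslice C 0 ∪ hslice C 1)
    obtain ⟨mi, hi, hi'⟩ := ih (hslice C 0 ∩ hslice C 1)
    refine ⟨fun S => if S 0 = true then mi (Fin.tail S) else mu (Fin.tail S) + mi (Fin.tail S),
      ?_, ?_⟩
    · intro S u
      obtain ⟨s, S, rfl⟩ : ∃ s S', S = (Fin.cons s S' : Fin (n+1) → Bool) :=
        ⟨S 0, Fin.tail S, (Fin.cons_self_tail S).symm⟩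
      rw [card_hslice]
      simp only [Fin.cons_zero, Fin.tail_cons]
      cases s
      · rw [agr_hslice _ _ _ _ _ (by simp), agr_hslice _ _ _ _ _ (by simp)]
        simp only [Bool.false_eq_true, if_false]
        refine (add_le_add (hu S (Fin.tail u)) (hi S (Fin.tail u))).trans ?_
        rw [agr, agr, filter_union, filter_inter_distrib, card_union_add_card_inter]
        rfl
      · simp only [if_true]
        have h1 : ∀ j : Fin 2, mi S ≤ (agr (hslice C j) S (Fin.tail u)).card := by
          intro j
          refine (hi S (Fin.tail u)).trans (card_le_card (agr_mono ?_ _ _))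
          fin_cases j
          · exact inter_subset_left
          · exact inter_subset_right
        have h2 := h1 (u 0)
        rw [← agr_hslice C true S u (u 0) (by simp)] at h2
        generalize u 0 = j at *
        fin_cases j
        · exact h2.trans (Nat.le_add_right _ _)
        · exact h2.trans (Nat.le_add_left _ _)
    · have hc : (C.card : ℝ) = ((hslice C 0 ∪ hslice C 1).card : ℝ)
          + ((hslice C 0 ∩ hslice C 1).card : ℝ) := by
        rw [card_hslice, ← card_union_add_card_inter]; push_cast; rfl
      have hle : ((hslice C 0 ∩ hslice C 1).card : ℝ) ≤ ((hslice C 0 ∪ hslice C 1).card : ℝ) := by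
        exact_mod_cast card_le_card (inter_subset_left.trans subset_union_left)
      have h1 := hk _ _ (Nat.cast_nonneg _) hle
      rw [hc]
      rw [← (Fin.consEquiv (fun _ : Fin (n+1) => Bool)).sum_comp, Fintype.sum_prod_type]
      simp only [Fintype.sum_bool, Fin.consEquiv, Equiv.coe_fn_mk, Fin.prod_univ_succ,
        Fin.cons_zero, Fin.cons_succ, Fin.tail_cons, if_true, Bool.false_eq_true, if_false,
        one_mul]
      push_cast
      simp only [mul_add, Finset.sum_add_distrib, mul_assoc, ← Finset.mul_sum]
      have h2 := mul_le_mul_of_nonneg_left h1 (pow_nonneg hκ n)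
      have h3 := mul_le_mul_of_nonneg_left hi' (by linarith : 0 ≤ 1 + τ)
      rw [pow_succ]
      nlinarith

lemma soft_select (τ e ρ : ℝ) (n : ℕ) (hτ : 0 < τ)
    (m : (Fin n → Bool) → ℕ)
    (h : (ρ*(1+τ*e))^n ≤ ∑ S, (∏ i, if S i = true then τ else 1) * (m S : ℝ)) :
    ∃ S : Fin n → Bool, ρ^n * ∏ i, (if S i = true then e else 1) ≤ m S := by
  by_contra hn
  push Not at hn
  have h1 : ∑ S : Fin n → Bool, (∏ i, if S i = true then τ else 1) * (m S : ℝ)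
      < ∑ S : Fin n → Bool, (∏ i, if S i = true then τ else 1) *
        (ρ^n * ∏ i, (if S i = true then e else 1)) := by
    apply Finset.sum_lt_sum_of_nonempty univ_nonempty
    intro S _
    apply mul_lt_mul_of_pos_left (hn S)
    apply Finset.prod_pos
    intro i _
    split_ifs <;> linarith
  have h2 : ∑ S : Fin n → Bool, (∏ i, if S i = true then τ else 1) *
        (ρ^n * ∏ i, (if S i = true then e else 1)) = (ρ*(1+τ*e))^n := by
    have h3 : ∀ S : Fin n → Bool, (∏ i, if S i = true then τ else 1) *
        (ρ^n * ∏ i, (if S i = true then e else 1)) = ρ^n * ∏ i, (if S i = true then τ*e else 1) := by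
      intro S
      rw [mul_left_comm, ← Finset.prod_mul_distrib]
      congr 1
      apply Finset.prod_congr rfl
      intro i _
      split_ifs <;> simp
    simp only [h3, ← Finset.mul_sum]
    have h4 := (Finset.prod_univ_sum (fun _ : Fin n => (Finset.univ : Finset Bool))
      (fun _ b => if b = true then τ*e else 1))
    rw [Fintype.piFinset_univ] at h4
    rw [← h4]
    simp [mul_pow, add_comm]
  linarith

lemma power_ineq (g : ℕ) (hg : 0 < g) (X Y : ℝ) (hY : 0 ≤ Y) (hXY : Y ≤ X) :
    (2.3*(1-0.4225/g)/4^g)*(X+Y)^(2*g) ≤ X^(2*g) + (1+0.3225)*Y^(2*g) := by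
  have hgR : (1:ℝ) ≤ g := by exact_mod_cast hg
  rcases (add_nonneg (hY.trans hXY) hY).eq_or_lt with h0 | h0
  · have : X = 0 := by linarith
    have : Y = 0 := by linarith
    subst X; subst Y; simp [hg.ne']
  set c := (X+Y)/2 with hc
  have hcpos : 0 < c := by positivity
  set v := (X-Y)/(X+Y) with hv
  have hv0 : 0 ≤ v := div_nonneg (by linarith) h0.le
  have hv1 : v ≤ 1 := by rw [hv, div_le_one h0]; linarith
  have hX : X = c*(1+v) := by rw [hc, hv]; field_simp; ring
  have hY' : Y = c*(1-v) := by rw [hc, hv]; field_simp; ring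
  have hs : X + Y = 2*c := by rw [hc]; ring
  have main : 2.3*(1-0.4225/g) ≤ (1+v)^(2*g) + (1+0.3225)*(1-v)^(2*g) := by
    rcases le_total (0.65) (g*v) with h | h
    · have h1 := one_add_mul_le_pow (a := v) (by linarith) (2*g)
      have h2 : 0 ≤ (1-v)^(2*g) := by apply pow_nonneg; linarith
      have h3 : (0:ℝ) ≤ 0.4225/g := by positivity
      push_cast at h1
      nlinarith
    · have h1 : 0 ≤ ((1+v)^g - 1.15*(1-v)^g)^2 := sq_nonneg _
      have h2 := one_add_mul_le_pow (a := -v^2) (by nlinarith) g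
      have h3 : (1 + -v^2)^g = (1+v)^g*(1-v)^g := by rw [← mul_pow]; ring
      rw [h3] at h2
      have h4 : g*v^2 ≤ 0.4225/g := by
        rw [le_div_iff₀ (by linarith)]
        have : 0 ≤ g*v := by positivity
        nlinarith
      rw [mul_comm 2 g, pow_mul, pow_mul]
      nlinarith
  rw [hs, mul_pow 2 c, pow_mul 2 2 g]
  rw [hX, hY', mul_pow, mul_pow]
  have : 2.3*(1-0.4225/(g:ℝ))/4^g*((2^2)^g*c^(2*g)) = c^(2*g)*(2.3*(1-0.4225/(g:ℝ))) := by
    norm_num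
    field_simp
  rw [this]
  have := mul_le_mul_of_nonneg_left main (by positivity : 0 ≤ c^(2*g))
  linarith

lemma gibbs {β ι κ : Type*} [Fintype ι] [DecidableEq ι] (P : Finset β) (f : β → ι → κ)
    (hf : Set.InjOn f P) (T : Finset κ) (hT : ∀ p ∈ P, ∀ i, f p i ∈ T) (Q : ι → κ → ℝ)
    (hQ0 : ∀ i, ∀ k ∈ T, 0 ≤ Q i k) (hQ : ∀ i, ∑ k ∈ T, Q i k ≤ 1)
    (hpos : ∀ p ∈ P, ∀ i, 0 < Q i (f p i)) :
    (P.card:ℝ) * Real.log P.card ≤ ∑ p ∈ P, ∑ i, -Real.log (Q i (f p i)) := by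
  classical
  rcases P.eq_empty_or_nonempty with h | h
  · subst h; simp
  have hc : (0:ℝ) < P.card := by exact_mod_cast h.card_pos
  have h1 : ∑ p ∈ P, ∏ i, Q i (f p i) ≤ 1 := by
    calc ∑ p ∈ P, ∏ i, Q i (f p i) = ∑ w ∈ P.image f, ∏ i, Q i (w i) := by
          rw [Finset.sum_image hf]
      _ ≤ ∑ w ∈ Fintype.piFinset (fun _ : ι => T), ∏ i, Q i (w i) := by
          apply Finset.sum_le_sum_of_subset_of_nonneg
          · intro w hw
            obtain ⟨p, hp, rfl⟩ := Finset.mem_image.1 hw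
            exact Fintype.mem_piFinset.2 (hT p hp)
          · intro w hw _
            exact Finset.prod_nonneg fun i _ => hQ0 i _ (Fintype.mem_piFinset.1 hw i)
      _ = ∏ i, ∑ k ∈ T, Q i k := (Finset.prod_univ_sum _ _).symm
      _ ≤ 1 := Finset.prod_le_one (fun i _ => Finset.sum_nonneg (hQ0 i)) (fun i _ => hQ i)
  have h2 : ∀ p ∈ P, Real.log P.card - ∑ i, -Real.log (Q i (f p i))
      ≤ P.card * (∏ i, Q i (f p i)) - 1 := by
    intro p hp
    have hpr : 0 < ∏ i, Q i (f p i) := Finset.prod_pos fun i _ => hpos p hp i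
    have := Real.log_le_sub_one_of_pos (mul_pos hc hpr)
    rw [Real.log_mul hc.ne' hpr.ne', Real.log_prod (fun i _ => (hpos p hp i).ne')] at this
    rw [Finset.sum_neg_distrib]
    linarith
  have h3 := Finset.sum_le_sum h2
  simp only [Finset.sum_sub_distrib, Finset.sum_const, nsmul_eq_mul, ← Finset.mul_sum] at h3
  nlinarith

/-- bias of coordinate `i` in the family `A`. -/
noncomputable def bias {n : ℕ} (A : Finset (Fin n → Fin 2)) (i : Fin n) : ℝ :=
  1 - 2 * (∑ a ∈ A, ((a i : ℕ) : ℝ)) / A.card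

lemma fin2_real (j : Fin 2) : ((j:ℕ):ℝ) = 0 ∨ ((j:ℕ):ℝ) = 1 := by
  fin_cases j <;> simp

lemma single_sum {n : ℕ} (A : Finset (Fin n → Fin 2)) (i : Fin n) (F : ℕ → ℝ) :
    ∑ a ∈ A, F (a i : ℕ) = A.card * ((1 + bias A i)/2 * F 0 + (1 - bias A i)/2 * F 1) := by
  rcases A.eq_empty_or_nonempty with h | h
  · subst h; simp
  have hc : (A.card:ℝ) ≠ 0 := by exact_mod_cast h.card_pos.ne'
  have h1 : ∀ a ∈ A, F (a i : ℕ) = F 0 + ((a i : ℕ) : ℝ) * (F 1 - F 0) := by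
    intro a _
    generalize a i = j
    fin_cases j <;> simp
  rw [Finset.sum_congr rfl h1, Finset.sum_add_distrib, ← Finset.sum_mul]
  simp only [Finset.sum_const, nsmul_eq_mul, bias]
  field_simp
  ring

lemma pair_sum {n : ℕ} (A B : Finset (Fin n → Fin 2)) (i : Fin n) (F : ℕ → ℝ) :
    ∑ p ∈ A ×ˢ B, F ((p.1 i : ℕ) + (p.2 i : ℕ)) = A.card * B.card *
      ((1 + bias A i)*(1 + bias B i)/4 * F 0 + (1 - bias A i * bias B i)/2 * F 1
        + (1 - bias A i)*(1 - bias B i)/4 * F 2) := by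
  rw [Finset.sum_product]
  have h : ∀ a ∈ A, ∑ b ∈ B, F ((a i : ℕ) + (b i : ℕ)) =
      (fun k => B.card * ((1 + bias B i)/2 * F (k+0) + (1 - bias B i)/2 * F (k+1))) (a i : ℕ) := by
    intro a _
    exact single_sum B i (fun k => F ((a i : ℕ) + k))
  rw [Finset.sum_congr rfl h, single_sum A i
    (fun k => B.card * ((1 + bias B i)/2 * F (k+0) + (1 - bias B i)/2 * F (k+1)))]
  norm_num
  ring

lemma bias_range {n : ℕ} (A : Finset (Fin n → Fin 2)) (i : Fin n) :
    -1 ≤ bias A i ∧ bias A i ≤ 1 := by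
  rcases A.eq_empty_or_nonempty with h | h
  · subst h; simp [bias]
  have hc : (0:ℝ) < A.card := by exact_mod_cast h.card_pos
  have h0 : 0 ≤ ∑ a ∈ A, ((a i : ℕ) : ℝ) := Finset.sum_nonneg fun _ _ => Nat.cast_nonneg _
  have h1 : ∑ a ∈ A, ((a i : ℕ) : ℝ) ≤ A.card := by
    have : ∑ a ∈ A, ((a i : ℕ) : ℝ) ≤ ∑ a ∈ A, (1:ℝ) := Finset.sum_le_sum fun a _ => by
      rcases fin2_real (a i) with h | h <;> rw [h] <;> norm_num
    simpa using this
  unfold bias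
  constructor
  · have : 2 * (∑ a ∈ A, ((a i : ℕ) : ℝ)) / A.card ≤ 2 := by
      rw [div_le_iff₀ hc]; linarith
    linarith
  · have : 0 ≤ 2 * (∑ a ∈ A, ((a i : ℕ) : ℝ)) / A.card := by positivity
    linarith

lemma bias_pos {n : ℕ} (A : Finset (Fin n → Fin 2)) (i : Fin n) (a) (ha : a ∈ A) (h : a i = 0) :
    -1 < bias A i := by
  have hc : (0:ℝ) < A.card := by exact_mod_cast Finset.card_pos.2 ⟨a, ha⟩
  have h1 : ∑ a ∈ A, ((a i : ℕ) : ℝ) < A.card := by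
    have : ∑ a ∈ A, ((a i : ℕ) : ℝ) < ∑ a ∈ A, (1:ℝ) := Finset.sum_lt_sum (fun a _ => by
      rcases fin2_real (a i) with h | h <;> rw [h] <;> norm_num) ⟨a, ha, by simp [h]⟩
    simpa using this
  have : 2 * (∑ a ∈ A, ((a i : ℕ) : ℝ)) / A.card < 2 := by
    rw [div_lt_iff₀ hc]; linarith
  unfold bias
  linarith

lemma bias_lt {n : ℕ} (A : Finset (Fin n → Fin 2)) (i : Fin n) (a) (ha : a ∈ A) (h : a i = 1) :
    bias A i < 1 := by
  have hc : (0:ℝ) < A.card := by exact_mod_cast Finset.card_pos.2 ⟨a, ha⟩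
  have h1 : 0 < ∑ a ∈ A, ((a i : ℕ) : ℝ) :=
    Finset.sum_pos' (fun _ _ => Nat.cast_nonneg _) ⟨a, ha, by simp [h]⟩
  have : 0 < 2 * (∑ a ∈ A, ((a i : ℕ) : ℝ)) / A.card := by positivity
  unfold bias
  linarith

lemma mul_log_mul (c w : ℝ) (hc : 0 < c) : w * Real.log (c*w) = w * (Real.log c + Real.log w) := by
  rcases eq_or_ne w 0 with h | h
  · subst h; simp
  · rw [Real.log_mul hc.ne' h]

/-- entropy bound for one codebook -/
lemma ent1 {n : ℕ} (A : Finset (Fin n → Fin 2)) :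
    (A.card:ℝ) * Real.log A.card ≤ A.card * ∑ i, (Real.log 2 - GG (bias A i)) := by
  have h := gibbs A (fun a (i : Fin n) => ((a i : ℕ))) (by
      intro a _ b _ hab
      funext i
      exact Fin.ext (congrFun hab i)) (Finset.range 2) (by
      intro a _ i
      exact Finset.mem_range.2 (a i).2)
    (fun i k => if k = 0 then (1/2)*(1 + bias A i) else (1/2)*(1 - bias A i)) (by
      intro i k _
      have := bias_range A i
      split_ifs <;> linarith) (by
      intro i
      simp [Finset.sum_range_succ]
      linarith) (by
      intro a ha i
      have h01 : a i = 0 ∨ a i = 1 := by omega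
      rcases h01 with h | h
      · have := bias_pos A i a ha h
        simp [h]; linarith
      · have := bias_lt A i a ha h
        simp [h]; linarith)
  rw [Finset.sum_comm] at h
  refine h.trans (le_of_eq ?_)
  rw [Finset.mul_sum]
  apply Finset.sum_congr rfl
  intro i _
  rw [single_sum A i (fun k => -Real.log (if k = 0 then (1/2)*(1 + bias A i)
    else (1/2)*(1 - bias A i)))]
  simp only [if_true, one_ne_zero, if_false]
  congr 1
  have e1 := mul_log_mul (1/2) (1 + bias A i) (by norm_num)
  have e2 := mul_log_mul (1/2) (1 - bias A i) (by norm_num)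
  have e3 : Real.log (1/2) = - Real.log 2 := by rw [one_div, Real.log_inv]
  rw [e3] at e1 e2
  unfold GG
  linear_combination (-1/2)*e1 + (-1/2)*e2

lemma GG_one : GG 1 = Real.log 2 := by unfold GG; norm_num
lemma GG_neg_one : GG (-1) = Real.log 2 := by rw [GG_neg, GG_one]

lemma bias_const {n : ℕ} (A : Finset (Fin n → Fin 2)) (i : Fin n) (c : Fin 2)
    (h : ∀ a ∈ A, a i = c) (hA : A.Nonempty) : Real.log 2 - GG (bias A i) = 0 := by
  have hc : (A.card:ℝ) ≠ 0 := by exact_mod_cast hA.card_pos.ne'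
  have h1 : ∑ a ∈ A, ((a i : ℕ) : ℝ) = A.card * ((c:ℕ):ℝ) := by
    rw [Finset.sum_congr rfl (fun a ha => by rw [h a ha])]
    simp
  unfold bias
  rw [h1]
  rcases fin2_real c with h | h <;> rw [h]
  · simp [GG_one]
  · rw [show (1:ℝ) - 2*(A.card*1)/A.card = -1 by field_simp; norm_num, GG_neg_one, sub_self]

lemma sum_zero_one (a b : Fin 2) : (a:ℕ) + (b:ℕ) = 0 ∧ a = 0 ∧ b = 0 ∨
    (a:ℕ) + (b:ℕ) = 1 ∨ (a:ℕ) + (b:ℕ) = 2 ∧ a = 1 ∧ b = 1 := by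
  fin_cases a <;> fin_cases b <;> simp

lemma zt (x y : ℝ) (hx : -1 ≤ x) (hx1 : x ≤ 1) (hy : -1 ≤ y) (hy1 : y ≤ 1) :
    (1+x)*(1+y) = (1+x*y)*(1 + (x+y)/(1+x*y)) ∧ (1-x)*(1-y) = (1+x*y)*(1 - (x+y)/(1+x*y)) := by
  have h0 : 0 ≤ 1 + x*y := by nlinarith
  rcases h0.eq_or_lt with h | h
  · rw [← h]
    have h1 : (1+x)*(1+y) + (1-x)*(1-y) = 0 := by linarith
    have h2 : 0 ≤ (1+x)*(1+y) := mul_nonneg (by linarith) (by linarith)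
    have h3 : 0 ≤ (1-x)*(1-y) := mul_nonneg (by linarith) (by linarith)
    constructor <;> linarith
  · constructor <;> field_simp <;> ring

/-- entropy bound for a pair of independent codebooks -/
lemma ent2 {n : ℕ} (A B : Finset (Fin n → Fin 2)) (S : Finset (Fin n))
    (hS : ∀ a ∈ A, ∀ b ∈ B, ∀ i ∈ S, (a i : ℕ) + (b i : ℕ) = 1)
    (hinj : Set.InjOn (fun p : (Fin n → Fin 2) × (Fin n → Fin 2) => fun i : Fin n =>
      (p.1 i : ℕ) + (p.2 i : ℕ)) (↑(A ×ˢ B))) :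
    (A.card * B.card : ℝ) * Real.log (A.card * B.card) ≤ A.card * B.card * ∑ i ∈ Sᶜ,
      ((1 - bias A i * bias B i)/2 * (-Real.log 0.47) + (1 + bias A i * bias B i)/2 *
        (-Real.log 0.265 - GG ((bias A i + bias B i)/(1 + bias A i * bias B i)))) := by
  set z : Fin n → ℝ := fun i => (bias A i + bias B i)/(1 + bias A i * bias B i) with hz
  set Q : Fin n → ℕ → ℝ := fun i k => if i ∈ S then (if k = 1 then 1 else 0) else
    (if k = 0 then 0.265*(1 + z i) else if k = 1 then 0.47 else 0.265*(1 - z i)) with hQ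
  have hzr : ∀ i, -1 ≤ z i ∧ z i ≤ 1 := fun i =>
    z_range _ _ (bias_range A i).1 (bias_range A i).2 (bias_range B i).1 (bias_range B i).2
  have h := gibbs (A ×ˢ B) _ hinj (Finset.range 3) (by
      intro p _ i
      have := (p.1 i).2
      have := (p.2 i).2
      simp only [Finset.mem_range]
      omega) Q (by
      intro i k _
      have := hzr i
      simp only [hQ]
      split_ifs <;> linarith) (by
      intro i
      simp only [hQ, Finset.sum_range_succ, Finset.sum_range_zero]
      by_cases hi : i ∈ S
      · simp [hi]
      · simp [hi]; linarith) (by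
      intro p hp i
      obtain ⟨ha, hb⟩ := Finset.mem_product.1 hp
      simp only [hQ]
      by_cases hi : i ∈ S
      · simp [hi, hS _ ha _ hb i hi]
      · simp only [hi, if_false]
        have rA := bias_range A i
        have rB := bias_range B i
        have ht : 0 ≤ 1 + bias A i * bias B i := by nlinarith
        have e := zt _ _ rA.1 rA.2 rB.1 rB.2
        rcases sum_zero_one (p.1 i) (p.2 i) with ⟨h, h1, h2⟩ | h | ⟨h, h1, h2⟩
        · have b1 := bias_pos A i _ ha h1
          have b2 := bias_pos B i _ hb h2
          have : 0 < (1 + bias A i) * (1 + bias B i) := mul_pos (by linarith) (by linarith)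
          rw [e.1] at this
          have := pos_of_mul_pos_right this ht
          simp only [h, if_true]
          linarith
        · simp [h]; norm_num
        · have b1 := bias_lt A i _ ha h1
          have b2 := bias_lt B i _ hb h2
          have : 0 < (1 - bias A i) * (1 - bias B i) := mul_pos (by linarith) (by linarith)
          rw [e.2] at this
          have := pos_of_mul_pos_right this ht
          simp only [h]
          norm_num
          linarith)
  rw [Finset.sum_comm, Finset.card_product] at h
  push_cast at h
  refine h.trans (le_of_eq ?_)
  rw [Finset.mul_sum, ← Finset.sum_add_sum_compl S]
  have hS0 : ∑ i ∈ S, ∑ p ∈ A ×ˢ B, -Real.log (Q i ((p.1 i : ℕ) + (p.2 i : ℕ))) = 0 := by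
    apply Finset.sum_eq_zero
    intro i hi
    apply Finset.sum_eq_zero
    intro p hp
    obtain ⟨ha, hb⟩ := Finset.mem_product.1 hp
    simp [hQ, hi, hS _ ha _ hb i hi]
  rw [hS0, zero_add]
  apply Finset.sum_congr rfl
  intro i hi
  have hi' : i ∉ S := Finset.mem_compl.1 hi
  rw [pair_sum A B i (fun k => -Real.log (Q i k))]
  congr 1
  have rA := bias_range A i
  have rB := bias_range B i
  have e := zt _ _ rA.1 rA.2 rB.1 rB.2
  have e1 := mul_log_mul 0.265 (1 + z i) (by norm_num)
  have e2 := mul_log_mul 0.265 (1 - z i) (by norm_num)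
  rw [e.1, e.2]
  change (1 + bias A i * bias B i) * (1 + z i) / 4 * _ + _ +
    (1 + bias A i * bias B i) * (1 - z i) / 4 * _ = _ + _ * (_ - GG (z i))
  simp only [hQ, hi', if_false, if_true, one_ne_zero, two_ne_zero, OfNat.ofNat_ne_one]
  unfold GG
  linear_combination (-(1 + bias A i * bias B i)/4)*e1 + (-(1 + bias A i * bias B i)/4)*e2

/-- entropy bound for the whole (dependent) family of pairs -/
lemma entAll {n : ℕ} {U : Type*} [Fintype U] (A B : U → Finset (Fin n → Fin 2))
    (S : Finset (Fin n)) (N M : ℝ) (hN : ∀ v, ((A v).card : ℝ) = N)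
    (hM : ∑ v, ((B v).card : ℝ) = M)
    (hS : ∀ v, ∀ a ∈ A v, ∀ b ∈ B v, ∀ i ∈ S, (a i : ℕ) + (b i : ℕ) = 1)
    (hinj : ∀ v w, ∀ a ∈ A v, ∀ b ∈ B v, ∀ a' ∈ A w, ∀ b' ∈ B w,
      (∀ i, (a i : ℕ) + (b i : ℕ) = (a' i : ℕ) + (b' i : ℕ)) → v = w ∧ a = a' ∧ b = b') :
    N * M * Real.log (N * M) ≤ ∑ v, N * (B v).card * ∑ i ∈ Sᶜ,
      ((1 - bias (A v) i * bias (B v) i)/2 * (-Real.log 0.47)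
        + (1 + bias (A v) i * bias (B v) i)/2 * (-Real.log 0.265)) := by
  classical
  set P : Finset (Σ _ : U, (Fin n → Fin 2) × (Fin n → Fin 2)) :=
    Finset.univ.sigma (fun v => A v ×ˢ B v) with hP
  set Q : Fin n → ℕ → ℝ := fun i k => if i ∈ S then (if k = 1 then 1 else 0) else
    (if k = 1 then 0.47 else 0.265) with hQ
  have h := gibbs P (fun p (i : Fin n) => (p.2.1 i : ℕ) + (p.2.2 i : ℕ)) (by
      rintro ⟨v, a, b⟩ h1 ⟨w, a', b'⟩ h2 h3
      simp only [hP, Finset.coe_sigma, Set.mem_sigma_iff, Finset.mem_coe, Finset.mem_product] at h1 h2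
      obtain ⟨e1, e2, e3⟩ := hinj v w a h1.2.1 b h1.2.2 a' h2.2.1 b' h2.2.2 (fun i => congrFun h3 i)
      subst e1 e2 e3
      rfl) (Finset.range 3) (by
      intro p _ i
      have := (p.2.1 i).2
      have := (p.2.2 i).2
      simp only [Finset.mem_range]
      omega) Q (by
      intro i k _
      simp only [hQ]
      split_ifs <;> norm_num) (by
      intro i
      simp only [hQ, Finset.sum_range_succ, Finset.sum_range_zero]
      by_cases hi : i ∈ S
      · simp [hi]
      · simp [hi]; norm_num) (by
      intro p hp i
      simp only [hP, Finset.mem_sigma, Finset.mem_product] at hp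
      simp only [hQ]
      by_cases hi : i ∈ S
      · simp [hi, hS _ _ hp.2.1 _ hp.2.2 i hi]
      · simp only [hi, if_false]
        split_ifs <;> norm_num)
  have hc : (P.card : ℝ) = N * M := by
    rw [hP, Finset.card_sigma]
    push_cast
    rw [← hM, Finset.mul_sum]
    apply Finset.sum_congr rfl
    intro v _
    rw [Finset.card_product]; push_cast; rw [hN]
  rw [hc] at h
  refine h.trans (le_of_eq ?_)
  rw [hP, Finset.sum_sigma]
  apply Finset.sum_congr rfl
  intro v _
  dsimp only
  rw [Finset.sum_comm, Finset.mul_sum, ← Finset.sum_add_sum_compl S]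
  have hS0 : ∑ i ∈ S, ∑ p ∈ A v ×ˢ B v, -Real.log (Q i ((p.1 i : ℕ) + (p.2 i : ℕ))) = 0 := by
    apply Finset.sum_eq_zero
    intro i hi
    apply Finset.sum_eq_zero
    intro p hp
    obtain ⟨ha, hb⟩ := Finset.mem_product.1 hp
    simp [hQ, hi, hS _ _ ha _ hb i hi]
  rw [hS0, zero_add]
  apply Finset.sum_congr rfl
  intro i hi
  have hi' : i ∉ S := Finset.mem_compl.1 hi
  rw [pair_sum (A v) (B v) i (fun k => -Real.log (Q i k)), hN]
  congr 1
  simp only [hQ, hi', if_false, if_true, zero_ne_one, OfNat.ofNat_ne_one]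
  ring

lemma weights_entropy {U : Type*} [Fintype U] (m : U → ℕ) (M : ℝ) (hM : ∑ v, (m v : ℝ) = M)
    (hpos : 0 < M) (s : ℕ) (hU : (Fintype.card U : ℝ) = 2^s) :
    M * Real.log M - M * (s * Real.log 2) ≤ ∑ v, (m v : ℝ) * Real.log (m v) := by
  have h : ∀ v, (m v : ℝ) * (Real.log M - s * Real.log 2) - (m v : ℝ) * Real.log (m v)
      ≤ M / 2^s - m v := by
    intro v
    rcases Nat.eq_zero_or_pos (m v) with h0 | h0
    · rw [h0]; simp; positivity
    · have hm : (0:ℝ) < m v := by exact_mod_cast h0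
      have h1 := Real.log_le_sub_one_of_pos (show 0 < M / 2^s / m v by positivity)
      rw [Real.log_div (by positivity) hm.ne', Real.log_div hpos.ne' (by positivity),
        Real.log_pow] at h1
      have h2 := mul_le_mul_of_nonneg_left h1 hm.le
      have h3 : (m v : ℝ) * (M / 2^s / m v - 1) = M/2^s - m v := by field_simp
      linarith
  have h2 := Finset.sum_le_sum (fun v (_ : v ∈ Finset.univ) => h v)
  simp only [Finset.sum_sub_distrib, ← Finset.sum_mul, hM, Finset.sum_const, nsmul_eq_mul,
    Finset.card_univ, hU] at h2
  have h3 : (2:ℝ)^s * (M/2^s) = M := by field_simp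
  linarith

lemma log_ge_of_pow (a : ℝ) (j k : ℕ) (ha : 0 < a) (hk : 0 < k) (h : (1:ℝ) ≤ 2^j * a^k) :
    -((j:ℝ)/k) * Real.log 2 ≤ Real.log a := by
  have h1 := Real.log_nonneg h
  rw [Real.log_mul (by positivity) (by positivity), Real.log_pow, Real.log_pow] at h1
  have hk' : (0:ℝ) < k := by exact_mod_cast hk
  rw [neg_mul, div_mul_eq_mul_div, ← neg_div, div_le_iff₀ hk']
  linarith

set_option exponentiation.threshold 3000 in
lemma log_r1 : -Real.log 0.47 ≤ 0.75503 := by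
  have := log_ge_of_pow 0.47 1086 997 (by norm_num) (by norm_num) (by norm_num)
  have := Real.log_two_lt_d9
  norm_num at *
  linarith

set_option exponentiation.threshold 3000 in
lemma log_r2 : -Real.log 0.265 ≤ 1.32803 := by
  have := log_ge_of_pow 0.265 1094 571 (by norm_num) (by norm_num) (by norm_num)
  have := Real.log_two_lt_d9
  norm_num at *
  linarith

set_option exponentiation.threshold 3000 in
lemma log_e : -Real.log 0.4324 ≤ 0.83850 := by
  have := log_ge_of_pow 0.4324 75 62 (by norm_num) (by norm_num) (by norm_num)
  have := Real.log_two_lt_d9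
  norm_num at *
  linarith

set_option exponentiation.threshold 3000 in
lemma log_rho : 0.70224 ≤ Real.log 2.0183 := by
  have h : (2:ℝ)^463 ≤ 2.0183^457 := by norm_num
  have h1 := Real.log_le_log (by positivity) h
  rw [Real.log_pow, Real.log_pow] at h1
  have := Real.log_two_gt_d9
  norm_num at *
  linarith

lemma sum_combine {U : Type*} [Fintype U] (m F l : U → ℝ) (M x K : ℝ) (hM : ∑ v, m v = M)
    (h : ∀ v, m v * F v + 0.15 * (m v * (x + l v)) + 0.89 * (m v * x) ≤ m v * K) :
    ∑ v, m v * F v + 0.15 * (M * x + ∑ v, m v * l v) + 0.89 * (M * x) ≤ M * K := by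
  have h1 := Finset.sum_le_sum (fun v (_ : v ∈ (Finset.univ : Finset U)) => h v)
  simp only [Finset.sum_add_distrib, ← Finset.mul_sum, ← Finset.sum_mul, mul_add, hM] at h1
  linarith

lemma main_count {n : ℕ} (C1 C2 : Finset (Fin n → Fin 2)) (hz : ZeroErrorPair C1 C2)
    (S : Finset (Fin n)) (N : ℕ) (hN : 0 < N)
    (hA : ∀ u : Fin n → Fin 2, N ≤ (C1.filter (fun a => ∀ i ∈ S, a i = u i)).card)
    (hC2 : C2.Nonempty) :
    2.04 * Real.log N + 1.15 * Real.log C2.card ≤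
      (Sᶜ.card : ℝ) * (1.1977595 + 0.89 * Real.log 2) + 0.15 * (S.card * Real.log 2) := by
  classical
  let U := S → Fin 2
  have hex : ∀ v : U, ∃ A : Finset (Fin n → Fin 2), A ⊆ C1 ∧ A.card = N ∧
      ∀ a ∈ A, ∀ i (hi : i ∈ S), a i = 1 - v ⟨i, hi⟩ := by
    intro v
    obtain ⟨A, hA1, hA2⟩ := Finset.exists_subset_card_eq
      (hA (fun i => if hi : i ∈ S then 1 - v ⟨i, hi⟩ else 0))
    refine ⟨A, hA1.trans (Finset.filter_subset _ _), hA2, ?_⟩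
    intro a ha i hi
    have := (Finset.mem_filter.1 (hA1 ha)).2 i hi
    simpa [hi] using this
  choose A hA1 hA2 hA3 using hex
  let B : U → Finset (Fin n → Fin 2) := fun v => C2.filter (fun b => (fun i : S => b i) = v)
  have hB : ∀ v, ∀ b ∈ B v, b ∈ C2 ∧ ∀ i (hi : i ∈ S), b i = v ⟨i, hi⟩ := by
    intro v b hb
    obtain ⟨h1, h2⟩ := Finset.mem_filter.1 hb
    exact ⟨h1, fun i hi => congrFun h2 ⟨i, hi⟩⟩
  have hM : ∑ v, ((B v).card : ℝ) = C2.card := by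
    have := Finset.card_eq_sum_card_fiberwise (s := C2) (t := (Finset.univ : Finset U))
      (f := fun b => (fun i : S => b i)) (fun _ _ => Finset.mem_coe.2 (Finset.mem_univ _))
    rw [this]; push_cast; rfl
  have hS : ∀ v, ∀ a ∈ A v, ∀ b ∈ B v, ∀ i ∈ S, (a i : ℕ) + (b i : ℕ) = 1 := by
    intro v a ha b hb i hi
    rw [hA3 v a ha i hi, (hB v b hb).2 i hi]
    generalize v ⟨i, hi⟩ = j
    fin_cases j <;> rfl
  have hinj : ∀ v w, ∀ a ∈ A v, ∀ b ∈ B v, ∀ a' ∈ A w, ∀ b' ∈ B w,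
      (∀ i, (a i : ℕ) + (b i : ℕ) = (a' i : ℕ) + (b' i : ℕ)) → v = w ∧ a = a' ∧ b = b' := by
    intro v w a ha b hb a' ha' b' hb' h
    have := hz (show (a, b) ∈ (↑(C1 ×ˢ C2) : Set _) from
        Finset.mem_coe.2 (Finset.mem_product.2 ⟨hA1 v ha, (hB v b hb).1⟩))
      (show (a', b') ∈ (↑(C1 ×ˢ C2) : Set _) from
        Finset.mem_coe.2 (Finset.mem_product.2 ⟨hA1 w ha', (hB w b' hb').1⟩)) (funext h)
    obtain ⟨e1, e2⟩ := Prod.mk.inj this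
    refine ⟨?_, e1, e2⟩
    funext i
    rw [← (hB v b hb).2 i i.2, ← (hB w b' hb').2 i i.2, e2]
  have hNr : (0:ℝ) < N := by exact_mod_cast hN
  have hMr : (0:ℝ) < C2.card := by exact_mod_cast hC2.card_pos
  have E1 := entAll A B S N C2.card (fun v => by rw [hA2 v]) hM hS hinj
  have E4 := weights_entropy (fun v => (B v).card) C2.card hM hMr S.card (by
    simp [U])
  set M : ℝ := ((C2.card : ℕ) : ℝ) with hMdef
  have E2 : ∀ v, ((B v).card : ℝ) * (Real.log N + Real.log (B v).card) ≤ (B v).card * ∑ i ∈ Sᶜ,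
      ((1 - bias (A v) i * bias (B v) i)/2 * (-Real.log 0.47)
        + (1 + bias (A v) i * bias (B v) i)/2 * (-Real.log 0.265 -
        GG ((bias (A v) i + bias (B v) i)/(1 + bias (A v) i * bias (B v) i)))) := by
    intro v
    have h := ent2 (A v) (B v) S (hS v) (by
      rintro ⟨a, b⟩ h1 ⟨a', b'⟩ h2 h3
      obtain ⟨h11, h12⟩ := Finset.mem_product.1 (Finset.mem_coe.1 h1)
      obtain ⟨h21, h22⟩ := Finset.mem_product.1 (Finset.mem_coe.1 h2)
      obtain ⟨-, e1, e2⟩ := hinj v v a h11 b h12 a' h21 b' h22 (fun i => congrFun h3 i)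
      rw [e1, e2])
    rw [hA2 v] at h
    rcases Nat.eq_zero_or_pos (B v).card with h0 | h0
    · rw [h0]; simp
    · have hm : (0:ℝ) < (B v).card := by exact_mod_cast h0
      rw [Real.log_mul hNr.ne' hm.ne', mul_assoc, mul_assoc] at h
      exact le_of_mul_le_mul_left h hNr
  have E3 : ∀ v, Real.log N ≤ ∑ i ∈ Sᶜ, (Real.log 2 - GG (bias (A v) i)) := by
    intro v
    have h := ent1 (A v)
    have hne : (A v).Nonempty := by rw [← Finset.card_pos, hA2 v]; exact hN
    rw [hA2 v, ← Finset.sum_add_sum_compl S] at h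
    have h0 : ∑ i ∈ S, (Real.log 2 - GG (bias (A v) i)) = 0 :=
      Finset.sum_eq_zero fun i hi => bias_const (A v) i _ (fun a ha => hA3 v a ha i hi) hne
    rw [h0, zero_add] at h
    exact le_of_mul_le_mul_left h hNr
  -- divide E1 by N
  have E1' : M * (Real.log N + Real.log M) ≤ ∑ v, ((B v).card : ℝ) * ∑ i ∈ Sᶜ,
      ((1 - bias (A v) i * bias (B v) i)/2 * (-Real.log 0.47)
        + (1 + bias (A v) i * bias (B v) i)/2 * (-Real.log 0.265)) := by
    rw [Real.log_mul hNr.ne' hMr.ne'] at E1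
    simp only [mul_assoc] at E1
    rw [← Finset.mul_sum] at E1
    exact le_of_mul_le_mul_left E1 hNr
  have L : ∀ v i, ((1 - bias (A v) i * bias (B v) i)/2 * (-Real.log 0.47)
        + (1 + bias (A v) i * bias (B v) i)/2 * (-Real.log 0.265))
      + 0.15 * ((1 - bias (A v) i * bias (B v) i)/2 * (-Real.log 0.47)
        + (1 + bias (A v) i * bias (B v) i)/2 * (-Real.log 0.265 -
        GG ((bias (A v) i + bias (B v) i)/(1 + bias (A v) i * bias (B v) i))))
      + 0.89 * (Real.log 2 - GG (bias (A v) i)) ≤ 1.1977595 + 0.89 * Real.log 2 := by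
    intro v i
    have ra := bias_range (A v) i
    have rb := bias_range (B v) i
    have key := letter_ineq _ _ ra.1 ra.2 rb.1 rb.2
    generalize bias (A v) i = x at *
    generalize bias (B v) i = y at *
    have t1 : 0 ≤ (1 - x*y)/2 := by nlinarith
    have t2 : 0 ≤ (1 + x*y)/2 := by nlinarith
    have k1 := mul_le_mul_of_nonneg_left log_r1 t1
    have k2 := mul_le_mul_of_nonneg_left log_r2 t2
    linarith
  have tot : ∀ v, ((B v).card : ℝ) * (∑ i ∈ Sᶜ,
      ((1 - bias (A v) i * bias (B v) i)/2 * (-Real.log 0.47)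
        + (1 + bias (A v) i * bias (B v) i)/2 * (-Real.log 0.265)))
      + 0.15 * (((B v).card : ℝ) * (Real.log N + Real.log (B v).card))
      + 0.89 * (((B v).card : ℝ) * Real.log N)
      ≤ ((B v).card : ℝ) * (Sᶜ.card * (1.1977595 + 0.89 * Real.log 2)) := by
    intro v
    have h1 := Finset.sum_le_sum (fun i (_ : i ∈ Sᶜ) => L v i)
    rw [Finset.sum_add_distrib, Finset.sum_add_distrib, ← Finset.mul_sum, ← Finset.mul_sum,
      Finset.sum_const, nsmul_eq_mul] at h1
    have h2 := mul_le_mul_of_nonneg_left h1 (Nat.cast_nonneg (α := ℝ) (B v).card)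
    have h3 := E2 v
    have h4 := mul_le_mul_of_nonneg_left (E3 v) (Nat.cast_nonneg (α := ℝ) (B v).card)
    linarith
  have T := sum_combine _ _ _ _ _ _ hM tot
  have fin : M * (2.04 * Real.log N + 1.15 * Real.log M) ≤
      M * ((Sᶜ.card : ℝ) * (1.1977595 + 0.89 * Real.log 2) + 0.15 * (S.card * Real.log 2)) := by
    linarith
  exact le_of_mul_le_mul_left fin hMr

theorem adder_outer_bound_corner (R1 R2 : ℝ) (h : Admissible R1 R2) (hR1 : R1 = 1) :
    R2 ≤ 0.4794 := by
  subst hR1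
  obtain ⟨-, -, h⟩ := h
  obtain ⟨n, hn, C1, C2, hz, h1, h2⟩ := h (1/1000000000) (by norm_num) 1
  obtain ⟨g, hg⟩ : ∃ g : ℕ, g = 10000 := ⟨_, rfl⟩
  have hgR : (g:ℝ) = 10000 := by rw [hg]; norm_num
  have hg0 : 0 < g := by omega
  have hκ : (0:ℝ) ≤ 2.3*(1-0.4225/g)/4^g := by
    apply div_nonneg _ (by positivity)
    rw [hgR]; norm_num
  obtain ⟨m, hm1, hm2⟩ := soft (2*g) _ 0.3225 (by omega) hκ (by norm_num)
    (power_ineq g hg0) n C1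
  have hκc : ((2.0183:ℝ)*(1+0.3225*0.4324))^n ≤ (2.3*(1-0.4225/g)/4^g)^n * (C1.card:ℝ)^(2*g) := by
    have hc : ((2:ℝ)^((n:ℝ) * (1 - 1/1000000000)))^(2*g) ≤ (C1.card:ℝ)^(2*g) :=
      pow_le_pow_left₀ (by positivity) h1 _
    have e : ((2:ℝ)^((n:ℝ) * (1 - 1/1000000000)))^(2*g)
        = (4^g * (2:ℝ)^(-(2/100000):ℝ))^n := by
      rw [← Real.rpow_natCast, ← Real.rpow_mul (by norm_num),
        show (4:ℝ)^g = (2:ℝ)^((2*g:ℕ):ℝ) by rw [Real.rpow_natCast, pow_mul]; norm_num,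
        ← Real.rpow_add (by norm_num), ← Real.rpow_natCast (_ ^ _) n, ← Real.rpow_mul (by norm_num)]
      congr 1
      push_cast
      rw [hgR]
      ring
    rw [e] at hc
    refine le_trans ?_ (mul_le_mul_of_nonneg_left hc (pow_nonneg hκ n))
    rw [← mul_pow]
    apply pow_le_pow_left₀ (by norm_num)
    have e2 : 2.3*(1-0.4225/(g:ℝ))/4^g * (4^g * (2:ℝ)^(-(2/100000):ℝ))
        = 2.3*(1-0.4225/(g:ℝ)) * (2:ℝ)^(-(2/100000):ℝ) := by
      field_simp
    rw [e2, hgR]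
    have e3 : (1 - 2/100000 : ℝ) ≤ (2:ℝ)^(-(2/100000):ℝ) := by
      rw [Real.rpow_def_of_pos (by norm_num)]
      have := Real.add_one_le_exp (Real.log 2 * -(2/100000))
      have := Real.log_two_lt_d9
      linarith
    have := mul_le_mul_of_nonneg_left e3 (by norm_num : (0:ℝ) ≤ 2.3*(1-0.4225/10000))
    refine le_trans ?_ this
    norm_num
  obtain ⟨S, hS⟩ := soft_select 0.3225 0.4324 2.0183 n (by norm_num) m
    (hκc.trans hm2)
  set S' : Finset (Fin n) := Finset.univ.filter (fun i => S i = true) with hS'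
  have hprod : ∏ i, (if S i = true then (0.4324:ℝ) else 1) = 0.4324^S'.card := by
    rw [Finset.prod_ite]; simp [hS']
  rw [hprod] at hS
  have hNpos : (0:ℝ) < m S := lt_of_lt_of_le (by positivity) hS
  have hN : 0 < m S := by exact_mod_cast hNpos
  have hC2 : (0:ℝ) < C2.card := lt_of_lt_of_le (by positivity) h2
  have main := main_count C1 C2 hz S' (m S) hN (by
    intro u
    have := hm1 S u
    simpa [agr, hS'] using this) (Finset.card_pos.1 (by exact_mod_cast hC2))
  have l1 := Real.log_le_log (by positivity) hS
  rw [Real.log_mul (by positivity) (by positivity), Real.log_pow, Real.log_pow] at l1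
  have l2 := Real.log_le_log (by positivity) h2
  rw [Real.log_rpow (by norm_num)] at l2
  have hcard : ((S'ᶜ).card : ℝ) = n - S'.card := by
    have := Finset.card_add_card_compl S'
    rw [Fintype.card_fin] at this
    have h' : (S'.card : ℝ) + (S'ᶜ).card = n := by exact_mod_cast this
    linarith
  rw [hcard] at main
  have hnR : (1:ℝ) ≤ n := by exact_mod_cast hn
  have g1 := Real.log_two_gt_d9
  have g2 := Real.log_two_lt_d9
  have hs : 0 ≤ (S'.card : ℝ) * (1.1977595 + 0.74 * Real.log 2 + 2.04 * Real.log 0.4324) := by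
    apply mul_nonneg (Nat.cast_nonneg _)
    have := log_e
    linarith
  have hr := mul_le_mul_of_nonneg_left log_rho (by linarith : (0:ℝ) ≤ n)
  have h3 : (n:ℝ) * (1.15 * ((R2 - 1/1000000000) * Real.log 2))
      ≤ n * (1.1977595 + 0.89 * Real.log 2 - 2.04 * 0.70224) := by
    linarith
  have h4 := le_of_mul_le_mul_left h3 (by linarith)
  by_contra hcon
  push Not at hcon
  have h5 : (0.47935:ℝ) * Real.log 2 ≤ (R2 - 1/1000000000) * Real.log 2 :=
    mul_le_mul_of_nonneg_right (by linarith) (by linarith)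
  linarith
end

section
/- Let R ∈ [0,1] and ε > 0. There exists N such that for every n ≥ N, every codebook C ⊆ {0,1}^n with |C| ≥ 2^{n(R+ε)} shatters some subset S ⊆ [n] with |S| ≥ n·h⁻¹(R). -/
/-- The binary entropy function (base 2). -/
noncomputable def binH (p : ℝ) : ℝ :=
  -(p * Real.logb 2 p) - (1 - p) * Real.logb 2 (1 - p)

/-- The inverse of the binary entropy function, restricted to `[0, 1/2]`. -/
noncomputable def binHInv (y : ℝ) : ℝ :=
  sInf {p : ℝ | 0 ≤ p ∧ p ≤ 1 / 2 ∧ binH p = y}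

/-- `S ⊆ [n]` is shattered by `C ⊆ {0,1}^n`: every vector in `{0,1}^S` is the restriction
of some codeword of `C` to `S`. -/
def Shatters {n : ℕ} (C : Finset (Fin n → Fin 2)) (S : Finset (Fin n)) : Prop :=
  ∀ g : ↥S → Fin 2, ∃ c ∈ C, ∀ i : ↥S, c i.1 = g i

lemma binH_eq (p : ℝ) : binH p = Real.binEntropy p / Real.log 2 := by
  unfold binH Real.binEntropy Real.logb
  rw [Real.log_inv, Real.log_inv]; ring

lemma binH_cont : Continuous binH := by
  have : binH = fun p => Real.binEntropy p / Real.log 2 := funext binH_eq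
  rw [this]
  exact Real.binEntropy_continuous.div_const _

lemma binHInv_spec (R : ℝ) (hR : R ∈ Set.Icc (0 : ℝ) 1) :
    0 ≤ binHInv R ∧ binHInv R ≤ 1 / 2 ∧ binH (binHInv R) = R := by
  have hl : 0 < Real.log 2 := Real.log_pos (by norm_num)
  have h0 : binH 0 = 0 := by simp [binH_eq]
  have h1 : binH (1 / 2) = 1 := by
    rw [binH_eq, one_div, Real.binEntropy_two_inv, div_self hl.ne']
  have hne : {p : ℝ | 0 ≤ p ∧ p ≤ 1 / 2 ∧ binH p = R}.Nonempty := by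
    have := intermediate_value_Icc (a := (0 : ℝ)) (b := 1 / 2) (by norm_num) binH_cont.continuousOn
    rw [h0, h1] at this
    obtain ⟨p, hp, hpR⟩ := this hR
    exact ⟨p, hp.1, hp.2, hpR⟩
  have hcl : IsClosed {p : ℝ | 0 ≤ p ∧ p ≤ 1 / 2 ∧ binH p = R} :=
    (isClosed_le continuous_const continuous_id).inter
      ((isClosed_le continuous_id continuous_const).inter (isClosed_eq binH_cont continuous_const))
  exact hcl.csInf_mem hne ⟨0, fun p hp => hp.1⟩

/-- Entropy bound on the volume of a Hamming ball. -/
lemma card_small_le (n : ℕ) (p : ℝ) (hp : 0 < p) (hp2 : p ≤ 1 / 2) (F : Finset (Finset (Fin n)))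
    (hF : ∀ S ∈ F, (S.card : ℝ) ≤ n * p) : (F.card : ℝ) ≤ (2 : ℝ) ^ ((n : ℝ) * binH p) := by
  have hq : 0 < 1 - p := by linarith
  have hw : ∀ S ∈ F, (2 : ℝ) ^ (-((n : ℝ) * binH p)) ≤ p ^ S.card * (1 - p) ^ (n - S.card) := by
    intro S hS
    have hSn : S.card ≤ n := by simpa using S.card_le_univ
    rw [← Real.rpow_natCast p, ← Real.rpow_natCast (1 - p), Nat.cast_sub hSn,
      Real.rpow_def_of_pos hp, Real.rpow_def_of_pos hq, Real.rpow_def_of_pos two_pos,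
      ← Real.exp_add, Real.exp_le_exp]
    have hl : 0 < Real.log 2 := Real.log_pos (by norm_num)
    have hE : Real.log 2 * -((n : ℝ) * binH p)
        = n * p * Real.log p + (n - n * p) * Real.log (1 - p) := by
      unfold binH Real.logb; field_simp; ring
    rw [hE]
    have hlog : Real.log p ≤ Real.log (1 - p) := Real.log_le_log hp (by linarith)
    nlinarith [hF S hS]
  have hsum : ∑ S : Finset (Fin n), p ^ S.card * (1 - p) ^ (n - S.card) = 1 := by
    have := Fintype.sum_pow_mul_eq_add_pow (Fin n) p (1 - p)
    simpa using this
  have h1 : (F.card : ℝ) * (2 : ℝ) ^ (-((n : ℝ) * binH p)) ≤ 1 := by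
    rw [← hsum, ← nsmul_eq_mul]
    refine (Finset.card_nsmul_le_sum F _ _ hw).trans ?_
    exact Finset.sum_le_sum_of_subset_of_nonneg (Finset.subset_univ _)
      (fun S _ _ => by positivity)
  rw [Real.rpow_neg two_pos.le, ← div_eq_mul_inv, div_le_one (by positivity)] at h1
  exact h1

/-- Pajor's lemma for codebooks. -/
lemma exists_family (n : ℕ) (C : Finset (Fin n → Fin 2)) :
    ∃ F : Finset (Finset (Fin n)), C.card ≤ F.card ∧ ∀ S ∈ F, Shatters C S := by
  classical
  let f : (Fin n → Fin 2) → Finset (Fin n) := fun c => Finset.univ.filter (fun i => c i = 1)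
  have hf : Function.Injective f := by
    intro c d h
    funext i
    have : i ∈ f c ↔ i ∈ f d := by rw [h]
    simp only [f, Finset.mem_filter, Finset.mem_univ, true_and] at this
    omega
  refine ⟨(C.image f).shatterer, ?_, ?_⟩
  · rw [← Finset.card_image_of_injective C hf]
    exact Finset.card_le_card_shatterer _
  · intro S hS g
    rw [Finset.mem_shatterer] at hS
    obtain ⟨u, hu, hut⟩ := hS (t := S.filter (fun i => ∃ h : i ∈ S, g ⟨i, h⟩ = 1))
      (Finset.filter_subset _ _)
    obtain ⟨c, hc, rfl⟩ := Finset.mem_image.1 hu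
    refine ⟨c, hc, fun ⟨i, hi⟩ => ?_⟩
    have := Finset.ext_iff.1 hut i
    simp only [f, Finset.mem_inter, Finset.mem_filter, Finset.mem_univ, true_and, hi,
      exists_true_left] at this
    show c i = g ⟨i, hi⟩
    omega

/-- Any codebook of size at least `2^{n(R + ε)}` shatters a set of cardinality
at least `n·h⁻¹(R)`, for `n` large enough. -/
theorem large_code_shatters (R ε : ℝ) (hR : R ∈ Set.Icc (0 : ℝ) 1) (hε : 0 < ε) :
    ∃ N : ℕ, ∀ n : ℕ, N ≤ n → ∀ C : Finset (Fin n → Fin 2),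
      (2 : ℝ) ^ ((n : ℝ) * (R + ε)) ≤ C.card →
      ∃ S : Finset (Fin n), (n : ℝ) * binHInv R ≤ S.card ∧ Shatters C S := by

  obtain ⟨h0, h2, hH⟩ := binHInv_spec R hR
  refine ⟨1, fun n hn C hC => ?_⟩
  obtain ⟨F, hCF, hF⟩ := exists_family n C
  by_contra hcon
  push Not at hcon
  have hsmall : ∀ S ∈ F, (S.card : ℝ) < n * binHInv R := fun S hS => by
    by_contra h
    exact hcon S (not_lt.1 h) (hF S hS)
  have hn' : (1 : ℝ) ≤ n := by exact_mod_cast hn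
  have hCF' : (C.card : ℝ) ≤ F.card := by exact_mod_cast hCF
  have hFpos : 0 < (F.card : ℝ) :=
    lt_of_lt_of_le (Real.rpow_pos_of_pos two_pos _) (hC.trans hCF')
  rcases h0.eq_or_lt with h | h
  · obtain ⟨S, hS⟩ := Finset.card_pos.1 (by exact_mod_cast hFpos : 0 < F.card)
    have := hsmall S hS
    rw [← h, mul_zero] at this
    exact absurd this (not_lt.2 (Nat.cast_nonneg _))
  · have hb := card_small_le n _ h h2 F (fun S hS => (hsmall S hS).le)
    rw [hH] at hb
    have hlt : (2 : ℝ) ^ ((n : ℝ) * R) < (2 : ℝ) ^ ((n : ℝ) * (R + ε)) :=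
      Real.rpow_lt_rpow_of_exponent_lt one_lt_two (by nlinarith)
    linarith
end
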